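/- (Kepler's third law.) Under the Kepler hypotheses with 𝐥 ≠ 0 and h < 0, set a = −mk/(2h) (the semi-major axis) and τ = 2π·a^(3/2)/√k, so that τ² = (4π²/k)·a³. Then the motion is periodic with period τ: r(t + τ) = r(t) for all t ∈ ℝ. -/

import Mathlib

open scoped RealInnerProductSpace

/-- Cross product on `EuclideanSpace ℝ (Fin 3)`. -/
noncomputable def cross3 (v w : EuclideanSpace ℝ (Fin 3)) : EuclideanSpace ℝ (Fin 3) :=
  (EuclideanSpace.equiv (Fin 3) ℝ).symm
    (crossProduct ((EuclideanSpace.equiv (Fin 3) ℝ) v) ((EuclideanSpace.equiv (Fin 3) ℝ) w))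

section Regularization

variable {E : Type*} [NormedAddCommGroup E]

/-- Two differentiable curves with the same derivative that agree at `0` coincide. -/
theorem eq_of_hasDerivAt_eq_of_eq_zero [NormedSpace ℝ E] {f g f' : ℝ → E}
    (hf : ∀ t, HasDerivAt f (f' t) t) (hg : ∀ t, HasDerivAt g (f' t) t) (h0 : f 0 = g 0) (t : ℝ) :
    f t = g t := by
  have hd : ∀ t, HasDerivAt (fun t => f t - g t) 0 t := fun t => by
    simpa using (hf t).fun_sub (hg t)
  have hc := is_const_of_deriv_eq_zero (fun t => (hd t).differentiableAt) (fun t => (hd t).deriv) t 0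
  simpa [h0, sub_eq_zero] using hc

/-- The harmonic oscillator in the reparametrized time `θ`, where `dθ = ω / ρ dt`. -/
theorem harmonic_reparametrized [NormedSpace ℝ E] {ω : ℝ} (hω : ω ≠ 0) {ρ θ : ℝ → ℝ}
    {X W : ℝ → E} (hθ : ∀ t, HasDerivAt θ (ω / ρ t) t) (hθ0 : θ 0 = 0)
    (hX : ∀ t, HasDerivAt X ((ρ t)⁻¹ • W t) t)
    (hW : ∀ t, HasDerivAt W (-(ω ^ 2 / ρ t) • X t) t) (t : ℝ) :
    X t = Real.cos (θ t) • X 0 + (Real.sin (θ t) / ω) • W 0 := by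
  have hP : Real.cos (θ t) • X t - (Real.sin (θ t) / ω) • W t = X 0 := by
    refine eq_of_hasDerivAt_eq_of_eq_zero (f' := fun _ => 0)
      (f := fun t => Real.cos (θ t) • X t - (Real.sin (θ t) / ω) • W t)
      (fun t => ?_) (fun t => hasDerivAt_const t (X 0)) (by simp [hθ0]) t
    refine (((hθ t).cos.fun_smul (hX t)).fun_sub
      (((hθ t).sin.div_const ω).fun_smul (hW t))).congr_deriv ?_
    match_scalars <;> field_simp <;> ring
  have hQ : (Real.sin (θ t) * ω) • X t + Real.cos (θ t) • W t = W 0 := by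
    refine eq_of_hasDerivAt_eq_of_eq_zero (f' := fun _ => 0)
      (f := fun t => (Real.sin (θ t) * ω) • X t + Real.cos (θ t) • W t)
      (fun t => ?_) (fun t => hasDerivAt_const t (W 0)) (by simp [hθ0]) t
    refine ((((hθ t).sin.mul_const ω).fun_smul (hX t)).fun_add
      ((hθ t).cos.fun_smul (hW t))).congr_deriv ?_
    match_scalars <;> field_simp <;> ring
  rw [← hP, ← hQ]
  have hcs := Real.sin_sq_add_cos_sq (θ t)
  match_scalars
  · field_simp
    linarith
  · field_simp
    ring

/-- The map sending an eccentric anomaly to a multiple of the time is injective when the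
eccentricity is less than one. -/
theorem kepler_equation_injective {a α β : ℝ} (ha : 0 < a) (h : α ^ 2 + β ^ 2 < a ^ 2) :
    Function.Injective (fun x : ℝ => a * x + α * Real.sin x - β * Real.cos x) := by
  refine (strictMono_of_deriv_pos fun x => ?_).injective
  have hd : HasDerivAt (fun x : ℝ => a * x + α * Real.sin x - β * Real.cos x)
      (a * 1 + α * Real.cos x - β * -Real.sin x) x :=
    (((hasDerivAt_id' x).const_mul a).fun_add ((Real.hasDerivAt_sin x).const_mul α)).fun_sub
      ((Real.hasDerivAt_cos x).const_mul β)
  rw [hd.deriv]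
  have hsq : (α * Real.cos x + β * Real.sin x) ^ 2 < a ^ 2 := by
    nlinarith [Real.sin_sq_add_cos_sq x, sq_nonneg (α * Real.sin x - β * Real.cos x)]
  linarith [(abs_lt_of_sq_lt_sq' hsq ha.le).1]

/-- A noncollinear Kepler motion with specific energy `-k / (2 * a)`, where `k = ω² a`,
has period `2 * π * a / ω`. -/
theorem kepler_motion_periodic [InnerProductSpace ℝ E] {k a ω : ℝ} (ha : 0 < a) (hω : 0 < ω)
    (hk : ω ^ 2 * a = k) {r v : ℝ → E} (hrv : ∀ t, HasDerivAt r (v t) t)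
    (hv : ∀ t, HasDerivAt v (-(k / ‖r t‖ ^ 3) • r t) t) (hrne : ∀ t, r t ≠ 0)
    (hE : ‖v 0‖ ^ 2 - 2 * k / ‖r 0‖ = -ω ^ 2)
    (hL : ⟪r 0, v 0⟫ ^ 2 < ‖r 0‖ ^ 2 * ‖v 0‖ ^ 2) :
    Function.Periodic r (2 * Real.pi * a / ω) := by
  have hpos : ∀ t, 0 < ‖r t‖ := fun t => norm_pos_iff.2 (hrne t)
  have hρ : ∀ t, HasDerivAt (fun t => ‖r t‖) (⟪r t, v t⟫ / ‖r t‖) t := fun t => by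
    have hs := (hrv t).norm_sq.sqrt (pow_pos (hpos t) 2).ne'
    simp only [Real.sqrt_sq (norm_nonneg _)] at hs
    exact hs.congr_deriv (by have := hpos t; field_simp)
  have hinv : ∀ t, HasDerivAt (fun t => k / ‖r t‖) (-(k * ⟪r t, v t⟫ / ‖r t‖ ^ 3)) t := fun t =>
    ((hasDerivAt_const t k).fun_div (hρ t) (hpos t).ne').congr_deriv
      (by have := hpos t; field_simp; ring)
  have henergy : ∀ t, ‖v t‖ ^ 2 - 2 * (k / ‖r t‖) = -ω ^ 2 := by
    refine eq_of_hasDerivAt_eq_of_eq_zero (f' := fun _ => 0) (fun t => ?_)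
      (fun t => hasDerivAt_const t _) (by rw [← hE]; ring)
    refine ((hv t).norm_sq.fun_sub ((hinv t).const_mul 2)).congr_deriv ?_
    rw [inner_smul_right, real_inner_comm]
    ring
  have hσ : ∀ t, HasDerivAt (fun t => ⟪r t, v t⟫) (k / ‖r t‖ - ω ^ 2) t := fun t => by
    refine ((hrv t).inner ℝ (hv t)).congr_deriv ?_
    rw [inner_smul_right, real_inner_self_eq_norm_sq, real_inner_self_eq_norm_sq]
    have h1 := henergy t
    have h2 : -(k / ‖r t‖ ^ 3) * ‖r t‖ ^ 2 = -(k / ‖r t‖) := by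
      have := hpos t
      field_simp
    linarith
  set y : ℝ → E := fun t => ⟪r t, v t⟫ • v t - (k / ‖r t‖) • r t with hy
  have hyd : ∀ t, HasDerivAt y (-ω ^ 2 • v t) t := fun t => by
    refine (((hσ t).fun_smul (hv t)).fun_sub ((hinv t).fun_smul (hrv t))).congr_deriv ?_
    match_scalars <;> field_simp <;> ring
  set c : E := r 0 + (1 / ω ^ 2) • y 0 with hc
  have hyc : ∀ t, y t = -ω ^ 2 • (r t - c) := by
    refine eq_of_hasDerivAt_eq_of_eq_zero hyd
      (fun t => ((hrv t).sub_const c).fun_const_smul (-ω ^ 2)) ?_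
    rw [hc]
    match_scalars <;> field_simp
    ring
  have hw : ∀ t, HasDerivAt (fun t => ‖r t‖ • v t) (-(ω ^ 2 / ‖r t‖) • (r t - c)) t := fun t => by
    refine ((hρ t).fun_smul (hv t)).congr_deriv ?_
    have h1 : -(ω ^ 2 / ‖r t‖) • (r t - c) = (‖r t‖)⁻¹ • y t := by
      rw [hyc, smul_smul]
      congr 1
      ring
    rw [h1, hy]
    have := hpos t
    match_scalars <;> field_simp
  obtain ⟨θ, hθ0, hθ⟩ : ∃ θ : ℝ → ℝ, θ 0 = 0 ∧ ∀ t, HasDerivAt θ (ω / ‖r t‖) t := by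
    have hcont : Continuous fun t => ω / ‖r t‖ := continuous_const.div
      (continuous_iff_continuousAt.2 fun t => (hρ t).continuousAt) fun t => (hpos t).ne'
    exact ⟨fun t => ∫ x in (0 : ℝ)..t, ω / ‖r x‖, by simp,
      fun t => (hcont.integral_hasStrictDerivAt 0 t).hasDerivAt⟩
  have hrθ := harmonic_reparametrized hω.ne' hθ hθ0 (X := fun t => r t - c)
    (fun t => ((hrv t).sub_const c).congr_deriv (by
      rw [smul_smul, inv_mul_cancel₀ (hpos t).ne', one_smul])) hw
  have hρθ := harmonic_reparametrized hω.ne' hθ hθ0 (X := fun t => ‖r t‖ - a)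
    (fun t => ((hρ t).sub_const a).congr_deriv (by rw [smul_eq_mul, div_eq_inv_mul]))
    (fun t => (hσ t).congr_deriv (by
      have := hpos t
      rw [smul_eq_mul, ← hk]
      field_simp
      ring))
  simp only [smul_eq_mul] at hρθ
  set α := ‖r 0‖ - a with hα
  set β := ⟪r 0, v 0⟫ / ω with hβ
  have hecc : α ^ 2 + β ^ 2 < a ^ 2 := by
    have h0 := hpos 0
    have h1 : ‖r 0‖ ^ 2 * ‖v 0‖ ^ 2 = 2 * k * ‖r 0‖ - ω ^ 2 * ‖r 0‖ ^ 2 := by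
      rw [show ‖v 0‖ ^ 2 = 2 * k / ‖r 0‖ - ω ^ 2 by linarith]
      field_simp
    have h2 : β ^ 2 < 2 * a * ‖r 0‖ - ‖r 0‖ ^ 2 := by
      rw [hβ, div_pow, div_lt_iff₀ (by positivity)]
      rw [h1, ← hk] at hL
      linarith
    rw [hα]
    linarith
  have hkepler : ∀ t, a * θ t + α * Real.sin (θ t) - β * Real.cos (θ t) = ω * t - β := by
    refine eq_of_hasDerivAt_eq_of_eq_zero (f' := fun _ => ω) (fun t => ?_)
      (fun t => (((hasDerivAt_id' t).const_mul ω).sub_const β).congr_deriv (mul_one ω))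
      (by simp [hθ0])
    refine ((((hθ t).const_mul a).fun_add ((hθ t).sin.const_mul α)).fun_sub
      ((hθ t).cos.const_mul β)).congr_deriv ?_
    have h1 : ‖r t‖ = a + Real.cos (θ t) * α + Real.sin (θ t) * β := by
      have := hρθ t
      rw [hβ]
      linear_combination this
    have h2 : ω = ‖r t‖ * (ω / ‖r t‖) := by
      have := hpos t
      field_simp
    linear_combination -h2 - (ω / ‖r t‖) * h1
  intro t
  have hshift : θ (t + 2 * Real.pi * a / ω) = θ t + 2 * Real.pi := by
    apply kepler_equation_injective ha hecc
    simp only [hkepler, Real.sin_add_two_pi, Real.cos_add_two_pi]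
    have h1 := hkepler t
    have h2 : ω * (2 * Real.pi * a / ω) = 2 * Real.pi * a := by field_simp
    linear_combination h2 - h1
  have h1 := hrθ (t + 2 * Real.pi * a / ω)
  simp only [hshift, Real.sin_add_two_pi, Real.cos_add_two_pi] at h1
  exact sub_left_injective (h1.trans (hrθ t).symm)

end Regularization

/-- Lagrange's identity for `cross3`. -/
theorem norm_cross3_sq (v w : EuclideanSpace ℝ (Fin 3)) :
    ‖cross3 v w‖ ^ 2 = ‖v‖ ^ 2 * ‖w‖ ^ 2 - ⟪v, w⟫ ^ 2 := by
  simp only [EuclideanSpace.norm_sq_eq, Fin.sum_univ_three, Real.norm_eq_abs, sq_abs,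
    PiLp.inner_apply, RCLike.inner_apply, conj_trivial, cross3, cross_apply]
  simp
  ring

/-- Kepler's third law: with semi-major axis `a = −mk/(2h)` and `τ = 2π·a^(3/2)/√k`
(so that `τ² = (4π²/k)·a³`), the motion is periodic with period `τ`. -/
theorem kepler_third_law
    (k m : ℝ) (hk : 0 < k) (hm : 0 < m)
    (r : ℝ → EuclideanSpace ℝ (Fin 3))
    (hr : Differentiable ℝ r) (hr' : Differentiable ℝ (deriv r))
    (hrne : ∀ t, r t ≠ 0)
    (heq : ∀ t, deriv (deriv r) t = -(k / ‖r t‖ ^ 3) • r t)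
    (L : EuclideanSpace ℝ (Fin 3)) (hL : L = m • cross3 (r 0) (deriv r 0)) (hLne : L ≠ 0)
    (h : ℝ) (hh : h = m * ‖deriv r 0‖ ^ 2 / 2 - m * k / ‖r 0‖) (hhneg : h < 0)
    (a τ : ℝ)
    (ha : a = -(m * k) / (2 * h))
    (hτ : τ = 2 * Real.pi * a ^ ((3:ℝ)/2) / Real.sqrt k) :
    ∀ t, r (t + τ) = r t := by
  have ha0 : 0 < a := by
    rw [ha]
    exact div_pos_of_neg_of_neg (by nlinarith) (by linarith)
  have hsk := Real.sqrt_pos.2 hk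
  have hsa := Real.sqrt_pos.2 ha0
  have hω2 : (Real.sqrt k / Real.sqrt a) ^ 2 = k / a := by
    rw [div_pow, Real.sq_sqrt hk.le, Real.sq_sqrt ha0.le]
  have hτ' : τ = 2 * Real.pi * a / (Real.sqrt k / Real.sqrt a) := by
    rw [hτ, show (3 : ℝ) / 2 = 1 + 1 / 2 by norm_num, Real.rpow_add ha0, Real.rpow_one,
      ← Real.sqrt_eq_rpow]
    field_simp
  rw [hτ']
  refine kepler_motion_periodic ha0 (div_pos hsk hsa) (by rw [hω2]; field_simp)
    (fun t => (hr t).hasDerivAt) (fun t => heq t ▸ (hr' t).hasDerivAt) hrne ?_ ?_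
  · have h1 : k / a = -(2 * h) / m := by
      rw [ha]
      field_simp
    rw [hω2, h1, hh]
    field_simp
  · have hcross : cross3 (r 0) (deriv r 0) ≠ 0 := fun h0 => hLne (by rw [hL, h0, smul_zero])
    have h1 := norm_cross3_sq (r 0) (deriv r 0)
    have h2 := pow_pos (norm_pos_iff.2 hcross) 2
    linarith
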